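/- Let q be a prime power, m and n positive integers with n ≤ m, C a nonzero F_{q^m}-linear subspace of (F_{q^m})^n of dimension k with C ≠ (F_{q^m})^n, and r an integer with 1 ≤ r ≤ k. Let B^r_t(C) = ∑_{U : dim U = t} #{ D ⊆ C(U) : dim_{F_{q^m}} D = r }, the sum over F_q-subspaces U of F_q^n of dimension t. Then: (i) if t > n − M_r(C) then B^r_t(C) = 0; (ii) if t < M_1(C^⊥) then B^r_t(C) = [n, t]_q · [k−t, r]_{q^m}. -/

import Mathlib

open Module

section Defs

variable (K : Type*) {L : Type*} [Field K] [Field L] [Algebra K L] {n : ℕ}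

/-- Orthogonal complement with respect to the standard (dot-product) bilinear form. -/
def perp {F : Type*} [Field F] {n : ℕ} (U : Submodule F (Fin n → F)) :
    Submodule F (Fin n → F) where
  carrier := {x | ∀ u ∈ U, ∑ i, x i * u i = 0}
  add_mem' := by
    intro a b ha hb u hu
    have h : ∑ i, (a + b) i * u i = (∑ i, a i * u i) + ∑ i, b i * u i := by
      simp [add_mul, Finset.sum_add_distrib]
    rw [h, ha u hu, hb u hu, add_zero]
  zero_mem' := by intro u hu; simp
  smul_mem' := by
    intro c a ha u hu
    have h : ∑ i, (c • a) i * u i = c * ∑ i, a i * u i := by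
      simp [Finset.mul_sum, mul_assoc]
    rw [h, ha u hu, mul_zero]

/-- The `K`-linear map `f ↦ (f (c i))ᵢ` on `Hom_K(L, K)`. -/
def rsuppAux (c : Fin n → L) : (L →ₗ[K] K) →ₗ[K] (Fin n → K) where
  toFun f := fun i => f (c i)
  map_add' f g := by funext i; simp
  map_smul' a f := by funext i; simp

@[simp] lemma rsuppAux_apply (c : Fin n → L) (f : L →ₗ[K] K) (i : Fin n) :
    rsuppAux K c f i = f (c i) := rfl

/-- The rank support of a vector `c ∈ Lⁿ`: the `K`-subspace
`{ (f (c 1), …, f (c n)) : f ∈ Hom_K(L, K) }` of `Kⁿ`. -/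
def Rsupp (c : Fin n → L) : Submodule K (Fin n → K) :=
  LinearMap.range (rsuppAux K c)

/-- The rank weight of a vector. -/
noncomputable def wtRvec (c : Fin n → L) : ℕ := finrank K (Rsupp K c)

/-- The rank support of an `L`-subspace `D ⊆ Lⁿ`: the `K`-span of the union of the
rank supports of its elements. -/
def RsuppSub (D : Submodule L (Fin n → L)) : Submodule K (Fin n → K) :=
  Submodule.span K (⋃ d ∈ (D : Set (Fin n → L)), (Rsupp K d : Set (Fin n → K)))

/-- The rank weight of a subspace. -/
noncomputable def wtR (D : Submodule L (Fin n → L)) : ℕ := finrank K (RsuppSub K D)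

/-- The subspace `{ c ∈ E : Rsupp(c) ⊆ V }` of elements of `E` whose rank support is
contained in `V`. -/
def rsuppIn (E : Submodule L (Fin n → L)) (V : Submodule K (Fin n → K)) :
    Submodule L (Fin n → L) where
  carrier := {c | c ∈ E ∧ Rsupp K c ≤ V}
  zero_mem' := by
    refine ⟨E.zero_mem, ?_⟩
    rintro v ⟨f, rfl⟩
    have h : rsuppAux K (0 : Fin n → L) f = 0 := by funext i; simp
    rw [h]; exact V.zero_mem
  add_mem' := by
    rintro a b ⟨haE, haR⟩ ⟨hbE, hbR⟩
    refine ⟨E.add_mem haE hbE, ?_⟩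
    rintro v ⟨f, rfl⟩
    have h : rsuppAux K (a + b) f = rsuppAux K a f + rsuppAux K b f := by
      funext i; simp
    rw [h]
    exact V.add_mem (haR ⟨f, rfl⟩) (hbR ⟨f, rfl⟩)
  smul_mem' := by
    rintro l a ⟨haE, haR⟩
    refine ⟨E.smul_mem l haE, ?_⟩
    rintro v ⟨f, rfl⟩
    have h : rsuppAux K (l • a) f = rsuppAux K a (f ∘ₗ LinearMap.mulLeft K l) := by
      funext i; simp [smul_eq_mul]
    rw [h]
    exact haR ⟨f ∘ₗ LinearMap.mulLeft K l, rfl⟩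

/-- Extension of scalars: the `L`-span of (the image in `Lⁿ` of) a `K`-subspace `U ⊆ Kⁿ`. -/
def extL (K L : Type*) [Field K] [Field L] [Algebra K L] {n : ℕ}
    (U : Submodule K (Fin n → K)) : Submodule L (Fin n → L) :=
  Submodule.span L
    ((fun u : Fin n → K => fun i => algebraMap K L (u i)) '' (U : Set (Fin n → K)))

/-- The minimum rank weight of a nonzero element of `E`. -/
noncomputable def minRW (E : Submodule L (Fin n → L)) : ℕ :=
  sInf {w | ∃ c ∈ E, c ≠ (0 : Fin n → L) ∧ wtRvec K c = w}

/-- The `r`-th generalized rank weight of `C`. -/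
noncomputable def genW (C : Submodule L (Fin n → L)) (r : ℕ) : ℕ :=
  sInf {w | ∃ D : Submodule L (Fin n → L), D ≤ C ∧ finrank L D = r ∧ wtR K D = w}

/-- The generalized rank weight distribution: the number of `r`-dimensional subspaces
of `C` of rank weight `w`. -/
noncomputable def Adist (C : Submodule L (Fin n → L)) (r w : ℕ) : ℕ :=
  Nat.card {D : Submodule L (Fin n → L) // D ≤ C ∧ finrank L D = r ∧ wtR K D = w}

/-- `B^r_t(C)`: the sum over all `t`-dimensional subspaces `U ⊆ Kⁿ` of the number of
`r`-dimensional subspaces of `C(U) = { c ∈ C : Rsupp(c) ⊆ U^⊥ }`. -/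
noncomputable def Bdist (C : Submodule L (Fin n → L)) (r t : ℕ) : ℕ :=
  ∑ᶠ (U : Submodule K (Fin n → K)) (_ : finrank K U = t),
    Nat.card {D : Submodule L (Fin n → L) // D ≤ rsuppIn K C (perp U) ∧ finrank L D = r}

end Defs

/-- The Gaussian binomial coefficient `[a, b]_q`. -/
def gaussBinom (q : ℕ) : ℕ → ℕ → ℕ
  | _, 0 => 1
  | 0, _ + 1 => 0
  | a + 1, b + 1 => gaussBinom q a b + q ^ (b + 1) * gaussBinom q a (b + 1)

theorem gaussBinom_mul_prod (q a b : ℕ) :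
    (gaussBinom q a b : ℤ) * ∏ i ∈ Finset.range b, ((q : ℤ) ^ b - (q : ℤ) ^ i) =
      ∏ i ∈ Finset.range b, ((q : ℤ) ^ a - (q : ℤ) ^ i) := by
  have step (c d : ℕ) : ∏ i ∈ Finset.range (d + 1), ((q : ℤ) ^ (c + 1) - (q : ℤ) ^ i) =
      ((q : ℤ) ^ (c + 1) - 1) * (q : ℤ) ^ d *
        ∏ i ∈ Finset.range d, ((q : ℤ) ^ c - (q : ℤ) ^ i) := by
    rw [Finset.prod_range_succ']
    have : ∀ i ∈ Finset.range d, (q : ℤ) ^ (c + 1) - (q : ℤ) ^ (i + 1) =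
        q * ((q : ℤ) ^ c - (q : ℤ) ^ i) := fun i _ => by ring
    rw [Finset.prod_congr rfl this, Finset.prod_mul_distrib]
    simp
    ring
  induction a generalizing b with
  | zero =>
    cases b with
    | zero => simp [gaussBinom]
    | succ b => simp [gaussBinom, Finset.prod_range_succ']
  | succ a ih =>
    cases b with
    | zero => simp [gaussBinom]
    | succ b =>
      have h1 := ih b
      have h2 := ih (b + 1)
      have h3 := step b b
      have h4 := step a b
      have h5 := Finset.prod_range_succ (fun i => (q : ℤ) ^ a - (q : ℤ) ^ i) b
      simp only [gaussBinom]
      push_cast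
      rw [add_mul, mul_assoc ((q : ℤ) ^ (b + 1)), h2, h3, h4, h5, ← h1]
      ring

theorem natCast_prod_pow_sub_pow {q a b : ℕ} (hq : 0 < q) (hab : b ≤ a) :
    ((∏ i : Fin b, (q ^ a - q ^ (i : ℕ)) : ℕ) : ℤ) =
      ∏ i ∈ Finset.range b, ((q : ℤ) ^ a - (q : ℤ) ^ i) := by
  rw [Finset.prod_range, Nat.cast_prod]
  refine Finset.prod_congr rfl fun i _ => ?_
  rw [Nat.cast_sub (Nat.pow_le_pow_right hq (by omega))]
  push_cast
  rfl

theorem gaussBinom_eq_zero {q a b : ℕ} (h : a < b) : gaussBinom q a b = 0 := by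
  induction a generalizing b with
  | zero =>
    obtain ⟨b, rfl⟩ := Nat.exists_eq_succ_of_ne_zero h.ne'
    rfl
  | succ a ih =>
    obtain ⟨b, rfl⟩ := Nat.exists_eq_succ_of_ne_zero (Nat.ne_zero_of_lt h)
    simp [gaussBinom, ih (show a < b by omega), ih (show a < b + 1 by omega)]

/-- Linearly independent `r`-tuples are counted by the `r`-dimensional subspaces they span. -/
theorem card_linearIndependent_eq_card_submodule_mul {F V : Type*} [Field F] [AddCommGroup V]
    [Module F V] [Fintype F] [Finite V] (r : ℕ) :
    Nat.card {s : Fin r → V // LinearIndependent F s} =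
      Nat.card {D : Submodule F V // finrank F D = r} *
        ∏ i : Fin r, (Fintype.card F ^ r - Fintype.card F ^ (i : ℕ)) := by
  have : Fintype {D : Submodule F V // finrank F D = r} := Fintype.ofFinite _
  let g : (Σ D : {D : Submodule F V // finrank F D = r},
      {s : Fin r → D.1 // LinearIndependent F s}) → {s : Fin r → V // LinearIndependent F s} :=
    fun x => ⟨fun i => (x.2.1 i : V), x.2.2.map' x.1.1.subtype (Submodule.ker_subtype _)⟩
  have span_eq (x) : Submodule.span F (Set.range (g x).1) = x.1.1 := by
    refine Submodule.eq_of_le_of_finrank_eq ?_ ?_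
    · rw [Submodule.span_le]
      rintro _ ⟨i, rfl⟩
      exact (x.2.1 i).2
    · rw [finrank_span_eq_card (g x).2, x.1.2, Fintype.card_fin]
  have hg : Function.Bijective g := by
    constructor
    · intro x y hxy
      have hD : x.1 = y.1 := Subtype.ext (by rw [← span_eq x, ← span_eq y, hxy])
      obtain ⟨D, s, hs⟩ := x
      obtain ⟨D', s', hs'⟩ := y
      obtain rfl : D = D' := hD
      have : s = s' := by
        funext i
        exact Subtype.ext (congrFun (congrArg Subtype.val hxy) i)
      subst this
      rfl
    · rintro ⟨s, hs⟩
      refine ⟨⟨⟨Submodule.span F (Set.range s), ?_⟩,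
        ⟨fun i => ⟨s i, Submodule.subset_span ⟨i, rfl⟩⟩, ?_⟩⟩, rfl⟩
      · rw [finrank_span_eq_card hs, Fintype.card_fin]
      · exact LinearIndependent.of_comp (Submodule.subtype _) hs
  rw [← Nat.card_congr (Equiv.ofBijective g hg), Nat.card_sigma,
    Finset.sum_congr rfl (g := fun _ =>
      ∏ i : Fin r, (Fintype.card F ^ r - Fintype.card F ^ (i : ℕ)))]
  · simp [Nat.card_eq_fintype_card]
  · rintro ⟨D, hD⟩ _
    rw [card_linearIndependent hD.ge, hD]

theorem card_submodule_finrank_eq {F V : Type*} [Field F] [AddCommGroup V] [Module F V]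
    [Fintype F] [Finite V] (r : ℕ) :
    Nat.card {D : Submodule F V // finrank F D = r} =
      gaussBinom (Fintype.card F) (finrank F V) r := by
  rcases lt_or_ge (finrank F V) r with h | h
  · rw [gaussBinom_eq_zero h, Nat.card_eq_zero]
    refine Or.inl ⟨fun D => ?_⟩
    have := Submodule.finrank_le D.1
    omega
  · have h1 := card_linearIndependent_eq_card_submodule_mul (F := F) (V := V) r
    rw [card_linearIndependent h] at h1
    have h2 := congrArg (Nat.cast : ℕ → ℤ) h1
    rw [Nat.cast_mul, natCast_prod_pow_sub_pow Fintype.card_pos h,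
      natCast_prod_pow_sub_pow Fintype.card_pos le_rfl, ← gaussBinom_mul_prod] at h2
    have hne : ∏ i ∈ Finset.range r,
        ((Fintype.card F : ℤ) ^ r - (Fintype.card F : ℤ) ^ i) ≠ 0 := by
      refine Finset.prod_ne_zero_iff.2 fun i hi => sub_ne_zero.2 fun heq => ?_
      have hlt := Nat.pow_lt_pow_right (Fintype.one_lt_card (α := F)) (Finset.mem_range.1 hi)
      exact hlt.ne' (by exact_mod_cast heq)
    exact_mod_cast (mul_right_cancel₀ hne h2).symm

theorem card_submodule_le_finrank_eq {F V : Type*} [Field F] [AddCommGroup V] [Module F V]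
    [Fintype F] [Finite V] (W : Submodule F V) (r : ℕ) :
    Nat.card {D : Submodule F V // D ≤ W ∧ finrank F D = r} =
      gaussBinom (Fintype.card F) (finrank F W) r := by
  rw [← card_submodule_finrank_eq]
  refine Nat.card_congr (Equiv.symm ?_)
  refine (Equiv.subtypeEquiv (Submodule.MapSubtype.orderIso W).toEquiv fun D => ?_).trans
    (Equiv.subtypeSubtypeEquivSubtypeInter _ (fun D : Submodule F V => finrank F D = r))
  change _ ↔ finrank F (D.map W.subtype) = r
  rw [Submodule.finrank_map_subtype_eq]

theorem mem_perp_span {F ι : Type*} [Field F] {n : ℕ} {v : ι → Fin n → F} {c : Fin n → F} :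
    c ∈ perp (Submodule.span F (Set.range v)) ↔ ∀ j, ∑ i, c i * v j i = 0 := by
  refine ⟨fun h j => h _ (Submodule.subset_span ⟨j, rfl⟩), fun h u hu => ?_⟩
  induction hu using Submodule.span_induction with
  | mem u hu =>
    obtain ⟨j, rfl⟩ := hu
    exact h j
  | zero => simp
  | add x y _ _ hx hy => simp [mul_add, Finset.sum_add_distrib, hx, hy]
  | smul a x _ hx =>
    simp only [Pi.smul_apply, smul_eq_mul, mul_left_comm _ a, ← Finset.mul_sum]
    rw [hx, mul_zero]

/-- The functionals `⟨·, v j⟩` are jointly surjective on `V` as soon as no nontrivial linear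
combination of the `v j` is orthogonal to `V`. -/
theorem finrank_inf_perp_span {F : Type*} [Field F] {n t : ℕ} (V : Submodule F (Fin n → F))
    (v : Fin t → Fin n → F) (h : ∀ a : Fin t → F, ∑ j, a j • v j ∈ perp V → a = 0) :
    finrank F ↥(V ⊓ perp (Submodule.span F (Set.range v))) + t = finrank F V := by
  let ψ : (Fin n → F) →ₗ[F] (Fin t → F) := Matrix.mulVecLin (Matrix.of v)
  have hψ (c j) : ψ c j = ∑ i, c i * v j i := by
    simp [ψ, Matrix.mulVec, dotProduct, mul_comm]
  have hsurj : LinearMap.range (ψ.domRestrict V) = ⊤ := by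
    by_contra hne
    obtain ⟨f, hf, hle⟩ := Submodule.exists_le_ker_of_lt_top _ (lt_top_iff_ne_top.2 hne)
    have hfa (x : Fin t → F) : f x = ∑ j, x j * f (Pi.single j 1) := by
      conv_lhs => rw [pi_eq_sum_univ' x]
      simp
    refine hf (LinearMap.ext fun x => ?_)
    have ha := h (fun j => f (Pi.single j 1)) fun c hc => ?_
    · rw [hfa]
      simp [fun j => congrFun ha j]
    · have hc0 : f (ψ c) = 0 := hle ⟨⟨c, hc⟩, rfl⟩
      rw [hfa] at hc0
      simp_rw [hψ, Finset.sum_mul] at hc0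
      simp only [Finset.sum_apply, Pi.smul_apply, smul_eq_mul, Finset.sum_mul]
      rw [Finset.sum_comm, ← hc0]
      exact Finset.sum_congr rfl fun j _ => Finset.sum_congr rfl fun i _ => by ring
  have hker : V ⊓ perp (Submodule.span F (Set.range v)) =
      (LinearMap.ker (ψ.domRestrict V)).map V.subtype := by
    ext c
    simp only [Submodule.mem_inf, Submodule.mem_map, LinearMap.mem_ker]
    constructor
    · rintro ⟨hc, hp⟩
      refine ⟨⟨c, hc⟩, funext fun j => ?_, rfl⟩
      exact (hψ c j).trans (mem_perp_span.1 hp j)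
    · rintro ⟨⟨c, hc⟩, h0, rfl⟩
      exact ⟨hc, mem_perp_span.2 fun j => (hψ c j).symm.trans (congrFun h0 j)⟩
  rw [hker, Submodule.finrank_map_subtype_eq,
    ← LinearMap.finrank_range_add_finrank_ker (ψ.domRestrict V), hsurj, finrank_top]
  simp [add_comm]

theorem perp_top {F : Type*} [Field F] {n : ℕ} : perp (⊤ : Submodule F (Fin n → F)) = ⊥ := by
  refine (Submodule.eq_bot_iff _).2 fun x hx => funext fun i => ?_
  simpa [Pi.single_apply] using hx (Pi.single i 1) trivial

theorem exists_linearIndependent_span_eq {F V : Type*} [Field F] [AddCommGroup V] [Module F V]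
    [FiniteDimensional F V] {U : Submodule F V} {t : ℕ} (hU : finrank F U = t) :
    ∃ v : Fin t → V, LinearIndependent F v ∧ Submodule.span F (Set.range v) = U := by
  let b := finBasisOfFinrankEq F U hU
  refine ⟨fun j => b j, b.linearIndependent.map' U.subtype (Submodule.ker_subtype _), ?_⟩
  have := congrArg (Submodule.map U.subtype) b.span_eq
  rwa [Submodule.map_span, ← Set.range_comp, Submodule.map_top, Submodule.range_subtype] at this

theorem finrank_perp_add {F : Type*} [Field F] {n : ℕ} (U : Submodule F (Fin n → F)) :
    finrank F (perp U) + finrank F U = n := by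
  obtain ⟨v, hv, hspan⟩ := exists_linearIndependent_span_eq (U := U) rfl
  have := finrank_inf_perp_span ⊤ v fun a ha => by
    rw [perp_top, Submodule.mem_bot] at ha
    exact funext (Fintype.linearIndependent_iff.1 hv a ha)
  rwa [hspan, top_inf_eq, finrank_top, finrank_fin_fun] at this

theorem sum_apply_mul {K L : Type*} [Field K] [Field L] [Algebra K L] {n : ℕ}
    (f : L →ₗ[K] K) (c : Fin n → L) (u : Fin n → K) :
    f (∑ i, c i * algebraMap K L (u i)) = ∑ i, f (c i) * u i := by
  rw [map_sum]
  refine Finset.sum_congr rfl fun i _ => ?_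
  rw [mul_comm, ← Algebra.smul_def, map_smul, smul_eq_mul, mul_comm]

theorem Rsupp_le_perp_iff {K L : Type*} [Field K] [Field L] [Algebra K L] {n : ℕ}
    (c : Fin n → L) (U : Submodule K (Fin n → K)) :
    Rsupp K c ≤ perp U ↔ ∀ u ∈ U, ∑ i, c i * algebraMap K L (u i) = 0 := by
  constructor
  · intro h u hu
    rw [← Module.forall_dual_apply_eq_zero_iff K]
    intro f
    rw [sum_apply_mul]
    exact h ⟨f, rfl⟩ u hu
  · rintro h _ ⟨f, rfl⟩ u hu
    simp only [rsuppAux_apply]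
    rw [← sum_apply_mul, h u hu, map_zero]

theorem rsuppIn_perp_span {K L : Type*} [Field K] [Field L] [Algebra K L] {n t : ℕ}
    (C : Submodule L (Fin n → L)) (v : Fin t → Fin n → K) :
    rsuppIn K C (perp (Submodule.span K (Set.range v))) =
      C ⊓ perp (Submodule.span L (Set.range fun j i => algebraMap K L (v j i))) := by
  ext c
  change c ∈ C ∧ Rsupp K c ≤ _ ↔ c ∈ C ∧ c ∈ perp _
  rw [Rsupp_le_perp_iff, mem_perp_span]
  refine and_congr_right fun _ =>
    ⟨fun h j => h _ (Submodule.subset_span ⟨j, rfl⟩), fun h u hu => ?_⟩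
  induction hu using Submodule.span_induction with
  | mem u hu =>
    obtain ⟨j, rfl⟩ := hu
    exact h j
  | zero => simp
  | add x y _ _ hx hy => simp [mul_add, Finset.sum_add_distrib, hx, hy]
  | smul a x _ hx =>
    simp only [Pi.smul_apply, smul_eq_mul, map_mul, mul_left_comm _ (algebraMap K L a),
      ← Finset.mul_sum]
    rw [hx, mul_zero]

theorem rsuppAux_sum_smul {K L : Type*} [Field K] [Field L] [Algebra K L] {n t : ℕ}
    (v : Fin t → Fin n → K) (a : Fin t → L) (f : L →ₗ[K] K) :
    rsuppAux K (∑ j, a j • fun i => algebraMap K L (v j i)) f = ∑ j, f (a j) • v j := by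
  funext i
  simp only [rsuppAux_apply, Finset.sum_apply, Pi.smul_apply, smul_eq_mul]
  exact sum_apply_mul f a fun j => v j i

theorem finrank_rsuppIn_perp {K L : Type*} [Field K] [Field L] [Algebra K L] {n : ℕ}
    (C : Submodule L (Fin n → L)) (U : Submodule K (Fin n → K))
    (hU : finrank K U < minRW K (perp C)) :
    finrank L (rsuppIn K C (perp U)) + finrank K U = finrank L C := by
  obtain ⟨v, hv, hspan⟩ := exists_linearIndependent_span_eq (U := U) rfl
  have := finrank_inf_perp_span C (fun j i => algebraMap K L (v j i)) fun a ha => by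
    by_contra hne
    have hx : ∑ j, a j • (fun i => algebraMap K L (v j i)) ≠ 0 := by
      refine fun hx => hne (funext fun j => ?_)
      rw [Pi.zero_apply, ← Module.forall_dual_apply_eq_zero_iff K]
      intro f
      refine Fintype.linearIndependent_iff.1 hv (fun j => f (a j)) ?_ j
      rw [← rsuppAux_sum_smul, hx]
      funext i
      simp
    have hle : Rsupp K (∑ j, a j • (fun i => algebraMap K L (v j i))) ≤ U := by
      rintro _ ⟨f, rfl⟩
      rw [rsuppAux_sum_smul]
      exact Submodule.sum_mem _ fun j _ =>
        Submodule.smul_mem _ _ (hspan.le (Submodule.subset_span ⟨j, rfl⟩))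
    have h1 : minRW K (perp C) ≤ wtRvec K _ := Nat.sInf_le ⟨_, ha, hx, rfl⟩
    exact absurd (h1.trans (Submodule.finrank_mono hle)) (not_le.2 hU)
  rwa [← rsuppIn_perp_span, hspan] at this

theorem genW_le_of_le_rsuppIn {K L : Type*} [Field K] [Field L] [Algebra K L] {n : ℕ}
    {C D : Submodule L (Fin n → L)} {V : Submodule K (Fin n → K)} (h : D ≤ rsuppIn K C V) :
    genW K C (finrank L D) ≤ finrank K V := by
  have h1 : genW K C (finrank L D) ≤ wtR K D :=
    Nat.sInf_le ⟨D, fun _ hd => (h hd).1, rfl, rfl⟩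
  refine h1.trans (Submodule.finrank_mono (Submodule.span_le.2 ?_))
  exact Set.iUnion₂_subset fun d hd => (h hd).2

/-- for a nonzero proper code `C` of dimension `k`, `n ≤ m` and `1 ≤ r ≤ k`:
(i) if `t > n − M_r(C)` then `B^r_t(C) = 0`;
(ii) if `t < M₁(C^⊥)` then `B^r_t(C) = [n, t]_q · [k−t, r]_{q^m}`. -/
theorem Bdist_formula {q m n : ℕ} (hq : IsPrimePow q) (hm : 0 < m) (hn : 0 < n)
    (hnm : n ≤ m) {K L : Type*} [Field K] [Field L] [Algebra K L] [Fintype K] [Fintype L]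
    (hK : Fintype.card K = q) (hL : Fintype.card L = q ^ m)
    (C : Submodule L (Fin n → L)) (hC : C ≠ ⊥) (hC' : C ≠ ⊤)
    (k : ℕ) (hk : finrank L C = k) (r : ℕ) (hr : 1 ≤ r) (hrk : r ≤ k) (t : ℕ) :
    (n - genW K C r < t → Bdist K C r t = 0) ∧
    (t < minRW K (perp C) →
      Bdist K C r t = gaussBinom q n t * gaussBinom (q ^ m) (k - t) r) := by
  constructor
  · intro ht
    refine finsum_mem_eq_zero_of_forall_eq_zero
      (s := {U : Submodule K (Fin n → K) | finrank K U = t}) fun U hU => ?_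
    rw [Nat.card_eq_zero]
    refine Or.inl ⟨?_⟩
    rintro ⟨D, hD, rfl⟩
    have h1 := genW_le_of_le_rsuppIn hD
    have h2 := finrank_perp_add U
    rw [Set.mem_ofPred_eq] at hU
    omega
  · intro ht
    have hterm (U) (hU : U ∈ {U : Submodule K (Fin n → K) | finrank K U = t}) :
        Nat.card {D : Submodule L (Fin n → L) // D ≤ rsuppIn K C (perp U) ∧ finrank L D = r} =
          gaussBinom (q ^ m) (k - t) r := by
      rw [Set.mem_ofPred_eq] at hU
      have h := finrank_rsuppIn_perp C U (hU ▸ ht)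
      rw [card_submodule_le_finrank_eq, hL]
      congr 1
      omega
    refine (finsum_mem_congr rfl hterm).trans ?_
    have hcard := card_submodule_finrank_eq (F := K) (V := Fin n → K) t
    rw [hK, finrank_fin_fun] at hcard
    rw [← hcard, ← finsum_set_coe_eq_finsum_mem]
    have := Fintype.ofFinite {U : Submodule K (Fin n → K) | finrank K U = t}
    rw [finsum_eq_sum_of_fintype, Finset.sum_const, smul_eq_mul, Finset.card_univ,
      ← Nat.card_eq_fintype_card]
    rfl
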